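/- Let R be a reduced root system with base Π, let 𝒦 = 𝒦(Π) be the cascade, and let K, K' ∈ 𝒦. If α ∈ Γ^K, γ ∈ Γ^{K'} and α + γ ∈ R, then either K ⊆ K' and α + γ ∈ Γ^{K'}, or K' ⊆ K and α + γ ∈ Γ^K. -/

import Mathlib

open Finset Module

open scoped Classical

/-- A reduced crystallographic root system in the `k`-vector space `V`, recorded through
the finite set `roots` of roots, the coroot linear forms `corootForm α = ⟨·, α^∨⟩`, and
the integer Cartan pairing `pairInt β α = ⟨β, α^∨⟩ ∈ ℤ` (meaningful when `α, β` are roots). -/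
structure RootSystemData (k V : Type*) [Field k] [CharZero k]
    [AddCommGroup V] [Module k V] where
  /-- the (finite) set of roots -/
  roots : Finset V
  /-- `corootForm α` is the linear form `⟨·, α^∨⟩` associated to the coroot of a root `α` -/
  corootForm : V → V →ₗ[k] k
  /-- the integer `⟨β, α^∨⟩`, recorded as `pairInt β α` -/
  pairInt : V → V → ℤ
  ne_zero : ∀ α ∈ roots, α ≠ (0 : V)
  span_eq_top : Submodule.span k (roots : Set V) = ⊤
  pair_compat : ∀ α ∈ roots, ∀ β ∈ roots, ((pairInt β α : ℤ) : k) = corootForm α β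
  pair_self : ∀ α ∈ roots, pairInt α α = 2
  reflect_mem : ∀ α ∈ roots, ∀ β ∈ roots, β - pairInt β α • α ∈ roots
  reduced : ∀ α ∈ roots, ∀ c : k, c • α ∈ roots → c = 1 ∨ c = -1

namespace RootSystemData

variable {k V : Type*} [Field k] [CharZero k] [AddCommGroup V] [Module k V]
variable (P : RootSystemData k V)

/-- A base (set of simple roots) of the root system: a linearly independent set of roots
such that every root is a nonnegative or nonpositive integral combination of its elements. -/
structure IsBase (B : Finset V) : Prop where
  subset : B ⊆ P.roots
  indep : LinearIndependent k (fun b : B => (b : V))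
  pos_or_neg : ∀ α ∈ P.roots,
    α ∈ AddSubmonoid.closure (B : Set V) ∨ -α ∈ AddSubmonoid.closure (B : Set V)

/-- The positive roots `R₊` with respect to a base `B`. -/
noncomputable def posRoots (B : Finset V) : Finset V :=
  P.roots.filter fun α => α ∈ AddSubmonoid.closure (B : Set V)

/-- `R^S = R ∩ ℤS`. -/
noncomputable def rootsOf (S : Finset V) : Finset V :=
  P.roots.filter fun α => α ∈ AddSubgroup.closure (S : Set V)

/-- `R₊^S = R ∩ ℕS`. -/
noncomputable def posRootsOf (S : Finset V) : Finset V :=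
  P.roots.filter fun α => α ∈ AddSubmonoid.closure (S : Set V)

/-- Two simple roots are linked in the Dynkin diagram of `S ⊆ Δ` when they can be joined
by a chain in `S` of consecutively non-orthogonal elements. -/
def Linked (S : Finset V) : V → V → Prop :=
  Relation.ReflTransGen fun a b => a ∈ S ∧ b ∈ S ∧ P.pairInt a b ≠ 0

/-- A subset of a base is connected if its Dynkin diagram is connected (and nonempty). -/
def IsConnected (S : Finset V) : Prop :=
  S.Nonempty ∧ ∀ a ∈ S, ∀ b ∈ S, P.Linked S a b

/-- `ε` is the highest root of `R^S`: a positive root of `R^S` such that `ε - α ∈ ℕS`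
for every root `α ∈ R^S`. -/
def IsHighestRoot (S : Finset V) (ε : V) : Prop :=
  ε ∈ P.posRootsOf S ∧ ∀ α ∈ P.rootsOf S, ε - α ∈ AddSubmonoid.closure (S : Set V)

/-- The highest root `ε_S` of `R^S` (junk value `0` if it does not exist). -/
noncomputable def highestRoot (S : Finset V) : V :=
  if h : ∃ ε, P.IsHighestRoot S ε then h.choose else 0

/-- The connected component of `a` in the Dynkin diagram of `S`. -/
noncomputable def component (S : Finset V) (a : V) : Finset V :=
  S.filter fun b => P.Linked S a b

/-- The connected components of the Dynkin diagram of `S`. -/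
noncomputable def components (S : Finset V) : Finset (Finset V) :=
  S.image fun a => P.component S a

/-- `{α ∈ S : ⟨α, ε_S^∨⟩ = 0}`. -/
noncomputable def zeroPart (S : Finset V) : Finset V :=
  S.filter fun a => P.pairInt a (P.highestRoot S) = 0

/-- Fuel-based auxiliary recursion for the cascade `𝒦(S)`; for an actual root system the
recursion terminates in at most `card S` steps, so fuel `card S + 1` computes `𝒦(S)`. -/
noncomputable def cascadeAux : ℕ → Finset V → Finset (Finset V)
  | 0, _ => ∅
  | n + 1, S => (P.components S).biUnion fun C => insert C (cascadeAux n (P.zeroPart C))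

/-- The cascade `𝒦(S)`, defined recursively by `𝒦(∅) = ∅`,
`𝒦(S) = 𝒦(S₁) ∪ ⋯ ∪ 𝒦(S_r)` if `S` has connected components `S₁, …, S_r`, and
`𝒦(S) = {S} ∪ 𝒦({α ∈ S : ⟨α, ε_S^∨⟩ = 0})` if `S` is connected. -/
noncomputable def cascade (S : Finset V) : Finset (Finset V) :=
  P.cascadeAux (S.card + 1) S

/-- `Γ^K = {α ∈ R^K : ⟨α, ε_K^∨⟩ > 0}`. -/
noncomputable def gamma (K : Finset V) : Finset V :=
  (P.rootsOf K).filter fun α => 0 < P.pairInt α (P.highestRoot K)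

end RootSystemData

namespace RootSystemData

variable {k V : Type*} [Field k] [CharZero k] [AddCommGroup V] [Module k V]
variable (P : RootSystemData k V)

theorem corootForm_self {α : V} (h : α ∈ P.roots) : P.corootForm α α = 2 := by
  rw [← P.pair_compat α h α h, P.pair_self α h]; norm_num

theorem mapsTo_refl {α : V} (h : α ∈ P.roots) :
    Set.MapsTo (preReflection α (P.corootForm α)) (P.roots : Set V) (P.roots : Set V) := by
  intro β hβ
  have := P.reflect_mem α h β hβ
  rw [preReflection_apply, ← P.pair_compat α h β hβ, Int.cast_smul_eq_zsmul]
  exact this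

theorem corootForm_injOn {α β : V} (hα : α ∈ P.roots) (hβ : β ∈ P.roots)
    (h : P.corootForm α = P.corootForm β) : α = β := by
  have : IsAddTorsionFree V := .of_isTorsionFree k V
  have h1 := P.corootForm_self hα
  have h2 := P.corootForm_self hβ
  exact eq_of_mapsTo_reflection_of_mem (R := k) (Φ := (P.roots : Set V)) P.roots.finite_toSet
    h1 h2 (h ▸ h1) (h ▸ h2) (P.mapsTo_refl hα) (P.mapsTo_refl hβ) hβ

theorem finDim (P : RootSystemData k V) : FiniteDimensional k V :=
  ⟨⟨P.roots, P.span_eq_top⟩⟩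

/-- The Mathlib root pairing attached to `P`. -/
theorem exists_pairing : ∃ Q : RootPairing P.roots k V (Dual k V),
    (∀ i, Q.root i = (i : V)) ∧ (∀ i j, Q.pairing i j = (P.pairInt i j : k)) := by
  have := P.finDim
  refine ⟨RootPairing.mk'' (Dual.eval k V) ⟨fun i => (i : V), Subtype.val_injective⟩
    ⟨fun i => P.corootForm i, fun i j h => Subtype.ext (P.corootForm_injOn i.2 j.2 h)⟩
    (fun i => P.corootForm_self i.2) ?_ ?_, ?_, ?_⟩
  · intro i
    have := P.mapsTo_refl i.2
    have hrg : Set.range (fun i : P.roots => (i : V)) = (P.roots : Set V) := by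
      ext x; simp
    change Set.MapsTo (preReflection (i : V) (P.corootForm i))
      (Set.range (fun i : P.roots => (i : V))) (Set.range (fun i : P.roots => (i : V)))
    rw [hrg]
    exact this
  · simpa using P.span_eq_top
  · intro i; rfl
  · intro i j
    exact (P.pair_compat j j.2 i i.2).symm

theorem key_facts : (∀ α ∈ P.roots, -α ∈ P.roots) ∧
    (∀ α ∈ P.roots, ∀ β ∈ P.roots, 0 < P.pairInt α β → 0 < P.pairInt β α) ∧
    (∀ α ∈ P.roots, ∀ β ∈ P.roots, P.pairInt α β = 0 → P.pairInt β α = 0) ∧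
    (∀ α ∈ P.roots, ∀ β ∈ P.roots, 0 < P.pairInt α β → α ≠ β → α - β ∈ P.roots) ∧
    (∀ α ∈ P.roots, ∀ β ∈ P.roots, P.pairInt α β < 0 → α ≠ -β → α + β ∈ P.roots) := by
  obtain ⟨Q, hr, hp⟩ := P.exists_pairing
  have hc : Q.IsCrystallographic := ⟨fun i j => ⟨P.pairInt i j, by simp [hp]⟩⟩
  have hin : ∀ i j, Q.pairingIn ℤ i j = P.pairInt i j := by
    intro i j
    have := Q.algebraMap_pairingIn ℤ i j
    rw [hp] at this
    simpa using this
  have hrange : Set.range Q.root = (P.roots : Set V) := by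
    ext x; simp [hr]
  refine ⟨?_, ?_, ?_, ?_, ?_⟩
  · intro α h
    have := P.reflect_mem α h α h
    rw [P.pair_self α h] at this
    convert this using 1
    rw [two_smul]; abel
  · intro α ha β hb h
    have := Q.zero_lt_pairingIn_iff' ℤ (i := ⟨α, ha⟩) (j := ⟨β, hb⟩)
    rw [hin, hin] at this
    exact this.1 h
  · intro α ha β hb h
    have := Q.pairingIn_eq_zero_iff (S := ℤ) (i := ⟨α, ha⟩) (j := ⟨β, hb⟩)
    rw [hin, hin] at this
    exact this.1 h
  · intro α ha β hb h hne
    have := Q.root_sub_root_mem_of_pairingIn_pos (i := ⟨α, ha⟩) (j := ⟨β, hb⟩) (by rwa [hin])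
      (by simpa using hne)
    rw [hrange] at this
    simpa [hr] using this
  · intro α ha β hb h hne
    have := Q.root_add_root_mem_of_pairingIn_neg (i := ⟨α, ha⟩) (j := ⟨β, hb⟩) (by rwa [hin])
      (by simpa [hr] using hne)
    rw [hrange] at this
    simpa [hr] using this

theorem exists_coords {Δ : Finset V} (hb : P.IsBase Δ) : ∃ C : V → V →+ ℚ,
    ∀ a ∈ Δ, ∀ b ∈ Δ, C a b = if a = b then 1 else 0 := by
  obtain ⟨π, hπ⟩ := LinearMap.exists_leftInverse_of_injective (Algebra.linearMap ℚ k)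
    (LinearMap.ker_eq_bot.2 (algebraMap ℚ k).injective)
  have hπ1 : π 1 = 1 := by
    have := LinearMap.congr_fun hπ 1
    simpa using this
  have h := hb.indep
  have hx : ∀ a : V, ∃ c : V →ₗ[k] k, a ∈ Δ → ∀ b ∈ Δ, c b = if a = b then 1 else 0 := by
    intro a
    obtain ⟨c, hc⟩ := LinearMap.exists_extend
      ((Basis.span h).constr k (fun b : Δ => if a = (b : V) then (1 : k) else 0))
    refine ⟨c, fun ha b hb => ?_⟩
    have h1 := LinearMap.congr_fun hc (Basis.span h ⟨b, hb⟩)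
    rw [Basis.constr_basis] at h1
    simpa [Basis.span_apply] using h1
  choose c hc using hx
  refine ⟨fun a => π.toAddMonoidHom.comp (c a).toAddMonoidHom, fun a ha b hb => ?_⟩
  have : π (c a b) = if a = b then 1 else 0 := by
    rw [hc a ha b hb]; split_ifs <;> simp [hπ1]
  exact this

variable {P}

theorem C_sum {Δ : Finset V} {C : V → V →+ ℚ}
    (hC : ∀ a ∈ Δ, ∀ b ∈ Δ, C a b = if a = b then 1 else 0) {S : Finset V} (hS : S ⊆ Δ)
    (f : V → ℕ) {b : V} (hb : b ∈ Δ) :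
    C b (∑ a ∈ S, f a • a) = if b ∈ S then (f b : ℚ) else 0 := by
  rw [map_sum]
  have : ∀ a ∈ S, C b (f a • a) = if b = a then (f a : ℚ) else 0 := by
    intro a ha
    rw [map_nsmul, hC b hb a (hS ha)]
    split_ifs <;> simp
  rw [Finset.sum_congr rfl this, Finset.sum_ite_eq]

theorem mem_nat {S : Finset V} {x : V} (h : x ∈ AddSubmonoid.closure (S : Set V)) :
    ∃ f : V → ℕ, x = ∑ a ∈ S, f a • a := by
  obtain ⟨f, -, hf⟩ := AddSubmonoid.mem_closure_finset.1 h
  exact ⟨f, hf.symm⟩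

theorem nat_mono {S T : Finset V} (h : S ⊆ T) {x : V}
    (hx : x ∈ AddSubmonoid.closure (S : Set V)) : x ∈ AddSubmonoid.closure (T : Set V) :=
  AddSubmonoid.closure_mono (by exact_mod_cast h) hx

theorem nat_int {S : Finset V} {x : V}
    (hx : x ∈ AddSubmonoid.closure (S : Set V)) : x ∈ AddSubgroup.closure (S : Set V) := by
  induction hx using AddSubmonoid.closure_induction with
  | mem x h => exact AddSubgroup.subset_closure h
  | zero => exact zero_mem _
  | add x y _ _ h1 h2 => exact add_mem h1 h2

theorem C_int {Δ : Finset V} {C : V → V →+ ℚ}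
    (hC : ∀ a ∈ Δ, ∀ b ∈ Δ, C a b = if a = b then 1 else 0) {S : Finset V} (hS : S ⊆ Δ)
    {x : V} (hx : x ∈ AddSubgroup.closure (S : Set V)) {b : V} (hb : b ∈ Δ) (hbS : b ∉ S) :
    C b x = 0 := by
  induction hx using AddSubgroup.closure_induction with
  | mem x h =>
    have hx : x ∈ S := by exact_mod_cast h
    rw [hC b hb x (hS hx), if_neg]
    rintro rfl; exact hbS hx
  | zero => simp
  | add x y _ _ h1 h2 => simp [h1, h2]
  | neg x _ h => simp [h]

theorem C_nonneg {Δ : Finset V} {C : V → V →+ ℚ}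
    (hC : ∀ a ∈ Δ, ∀ b ∈ Δ, C a b = if a = b then 1 else 0)
    {x : V} (hx : x ∈ AddSubmonoid.closure (Δ : Set V)) {b : V} (hb : b ∈ Δ) :
    0 ≤ C b x := by
  obtain ⟨f, rfl⟩ := mem_nat hx
  rw [C_sum hC (subset_refl _) f hb, if_pos hb]
  positivity

theorem C_ext {Δ : Finset V} {C : V → V →+ ℚ}
    (hC : ∀ a ∈ Δ, ∀ b ∈ Δ, C a b = if a = b then 1 else 0)
    {x : V} (hx : x ∈ AddSubmonoid.closure (Δ : Set V)) (h : ∀ b ∈ Δ, C b x = 0) : x = 0 := by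
  obtain ⟨f, rfl⟩ := mem_nat hx
  refine Finset.sum_eq_zero fun b hb => ?_
  have := h b hb
  rw [C_sum hC (subset_refl _) f hb, if_pos hb] at this
  have : f b = 0 := by exact_mod_cast this
  simp [this]

theorem nat_of_C {Δ : Finset V} {C : V → V →+ ℚ}
    (hC : ∀ a ∈ Δ, ∀ b ∈ Δ, C a b = if a = b then 1 else 0) {S : Finset V} (hS : S ⊆ Δ)
    {x : V} (hx : x ∈ AddSubmonoid.closure (Δ : Set V)) (h : ∀ b ∈ Δ, b ∉ S → C b x = 0) :
    x ∈ AddSubmonoid.closure (S : Set V) := by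
  obtain ⟨f, rfl⟩ := mem_nat hx
  refine sum_mem fun b hb => ?_
  by_cases hbS : b ∈ S
  · exact nsmul_mem (AddSubmonoid.subset_closure (by exact_mod_cast hbS)) _
  have := h b hb hbS
  rw [C_sum hC (subset_refl _) f hb, if_pos hb] at this
  have : f b = 0 := by exact_mod_cast this
  simp [this]

theorem pm_of_int {Δ : Finset V} (hb : P.IsBase Δ) {C : V → V →+ ℚ}
    (hC : ∀ a ∈ Δ, ∀ b ∈ Δ, C a b = if a = b then 1 else 0) {S : Finset V} (hS : S ⊆ Δ)
    {x : V} (hr : x ∈ P.roots) (hx : x ∈ AddSubgroup.closure (S : Set V)) :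
    x ∈ AddSubmonoid.closure (S : Set V) ∨ -x ∈ AddSubmonoid.closure (S : Set V) := by
  rcases hb.pos_or_neg x hr with h | h
  · exact .inl (nat_of_C hC hS h fun b hb hbS => C_int hC hS hx hb hbS)
  · exact .inr (nat_of_C hC hS h fun b hb hbS => C_int hC hS (neg_mem hx) hb hbS)

theorem pair_add {α β ε : V} (hα : α ∈ P.roots) (hβ : β ∈ P.roots) (hs : α + β ∈ P.roots)
    (hε : ε ∈ P.roots) : P.pairInt (α + β) ε = P.pairInt α ε + P.pairInt β ε := by
  have : ((P.pairInt (α + β) ε : ℤ) : k) = ((P.pairInt α ε + P.pairInt β ε : ℤ) : k) := by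
    push_cast
    rw [P.pair_compat ε hε _ hs, P.pair_compat ε hε _ hα, P.pair_compat ε hε _ hβ, map_add]
  exact_mod_cast this

theorem pair_sum {S : Finset V} (hS : S ⊆ P.roots) {f : V → ℕ} {β ε : V}
    (hβ : β ∈ P.roots) (hf : β = ∑ a ∈ S, f a • a)
    (hε : ε ∈ P.roots) : P.pairInt β ε = ∑ a ∈ S, (f a : ℤ) * P.pairInt a ε := by
  have : ((P.pairInt β ε : ℤ) : k) = ((∑ a ∈ S, (f a : ℤ) * P.pairInt a ε : ℤ) : k) := by
    push_cast
    rw [P.pair_compat ε hε _ hβ]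
    conv_lhs => rw [hf]
    rw [map_sum]
    refine Finset.sum_congr rfl fun a ha => ?_
    rw [map_nsmul, P.pair_compat ε hε _ (hS ha), nsmul_eq_mul]
  exact_mod_cast this

theorem pair_zero {S : Finset V} (hS : S ⊆ P.roots) {β ε : V}
    (hβ : β ∈ P.roots) (hβS : β ∈ AddSubgroup.closure (S : Set V))
    (hε : ε ∈ P.roots) (h : ∀ a ∈ S, P.pairInt a ε = 0) : P.pairInt β ε = 0 := by
  have : P.corootForm ε β = 0 := by
    clear hβ
    induction hβS using AddSubgroup.closure_induction with
    | mem x hx =>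
      have hx : x ∈ S := by exact_mod_cast hx
      rw [← P.pair_compat ε hε _ (hS hx), h x hx]; simp
    | zero => simp
    | add x y _ _ h1 h2 => simp [h1, h2]
    | neg x _ h => simp [h]
  rw [← P.pair_compat ε hε _ hβ] at this
  exact_mod_cast this

/-- Distinct simple roots pair nonpositively. -/
theorem pair_simple {Δ : Finset V} (hb : P.IsBase Δ) {a b : V} (ha : a ∈ Δ) (hb' : b ∈ Δ)
    (hne : a ≠ b) : P.pairInt a b ≤ 0 := by
  by_contra! hlt
  obtain ⟨C, hC⟩ := P.exists_coords hb
  have hr := P.key_facts.2.2.2.1 a (hb.subset ha) b (hb.subset hb') hlt hne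
  have h1 : C a (a - b) = 1 := by rw [map_sub, hC a ha a ha, hC a ha b hb']; simp [hne]
  have h2 : C b (a - b) = -1 := by rw [map_sub, hC b hb' a ha, hC b hb' b hb']; simp [hne.symm]
  rcases hb.pos_or_neg _ hr with h | h
  · have := C_nonneg hC h hb'; linarith
  · have := C_nonneg hC h ha; rw [map_neg] at this; linarith

/-- Disjoint orthogonal pieces: sums of roots are not roots. -/
theorem orth_false {Δ : Finset V} (hb : P.IsBase Δ) {K K' : Finset V} (hK : K ⊆ Δ) (hK' : K' ⊆ Δ)
    (h : ∀ a ∈ K, ∀ b ∈ K', a ≠ b ∧ P.pairInt a b = 0) {α γ : V} (hα : α ∈ P.roots)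
    (hαK : α ∈ AddSubgroup.closure (K : Set V)) (hγ : γ ∈ P.roots)
    (hγK : γ ∈ AddSubgroup.closure (K' : Set V)) (hs : α + γ ∈ P.roots) : False := by
  obtain ⟨C, hC⟩ := P.exists_coords hb
  obtain ⟨hneg, -, hsymm, -, -⟩ := P.key_facts
  have h0 : P.pairInt γ α = 0 := by
    refine pair_zero (hK'.trans hb.subset) hγ hγK hα fun b hbK => ?_
    refine hsymm _ hα _ (hb.subset (hK' hbK)) ?_
    exact pair_zero (hK.trans hb.subset) hα hαK (hb.subset (hK' hbK)) fun a ha => (h a ha b hbK).2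
  have h1 : P.pairInt (α + γ) α = 2 := by rw [pair_add hα hγ hs hα, h0, P.pair_self α hα]; rfl
  have hd : γ - α ∈ P.roots := by
    have := P.reflect_mem α hα _ hs
    rw [h1] at this
    convert this using 1
    rw [two_smul]; abel
  have nz : ∀ S : Finset V, S ⊆ Δ → ∀ x ∈ P.roots, x ∈ AddSubgroup.closure (S : Set V) →
      ∃ b ∈ S, C b x ≠ 0 := by
    intro S hS x hx hxS
    by_contra! hcon
    have hz : ∀ b ∈ Δ, C b x = 0 := fun b hb => by
      by_cases hbS : b ∈ S
      · exact hcon b hbS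
      · exact C_int hC hS hxS hb hbS
    rcases hb.pos_or_neg x hx with h | h
    · exact P.ne_zero x hx (C_ext hC h hz)
    · exact P.ne_zero x hx (neg_eq_zero.1 (C_ext hC h fun b hb => by simp [hz b hb]))
  obtain ⟨a, ha, hca⟩ := nz K hK α hα hαK
  obtain ⟨b, hbK, hcb⟩ := nz K' hK' γ hγ hγK
  have hab : C a γ = 0 := C_int hC hK' hγK (hK ha) fun h' => (h a ha a h').1 rfl
  have hba : C b α = 0 := C_int hC hK hαK (hK' hbK) fun h' => (h b h' b hbK).1 rfl
  have key : ∀ x ∈ P.roots, 0 ≤ C a x * C b x := by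
    intro x hx
    rcases hb.pos_or_neg x hx with h | h
    · exact mul_nonneg (C_nonneg hC h (hK ha)) (C_nonneg hC h (hK' hbK))
    · have := mul_nonneg (C_nonneg hC h (hK ha)) (C_nonneg hC h (hK' hbK))
      simpa using this
  have k1 := key _ hs
  have k2 := key _ hd
  simp only [map_add, map_sub, hab, hba] at k1 k2
  have : C a α * C b γ = 0 := by linarith
  exact (mul_ne_zero hca hcb) this

/-- Existence of the highest root. -/
theorem exists_highest {Δ : Finset V} (hb : P.IsBase Δ) {S : Finset V} (hS : S ⊆ Δ)
    (hconn : P.IsConnected S) : ∃ ε, P.IsHighestRoot S ε := by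
  obtain ⟨C, hC⟩ := P.exists_coords hb
  obtain ⟨hneg, hpos, hzero, hsub, hadd⟩ := P.key_facts
  have hSR : S ⊆ P.roots := hS.trans hb.subset
  have memS : ∀ a ∈ S, a ∈ AddSubmonoid.closure (S : Set V) := fun a ha =>
    AddSubmonoid.subset_closure (by exact_mod_cast ha)
  have antisymm : ∀ x : V, x ∈ AddSubmonoid.closure (S : Set V) →
      -x ∈ AddSubmonoid.closure (S : Set V) → x = 0 := by
    intro x h1 h2
    refine C_ext hC (nat_mono hS h1) fun b hb => le_antisymm ?_ (C_nonneg hC (nat_mono hS h1) hb)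
    have := C_nonneg hC (nat_mono hS h2) hb
    rw [map_neg] at this; linarith
  have mP : ∀ x, x ∈ P.posRootsOf S ↔ x ∈ P.roots ∧ x ∈ AddSubmonoid.closure (S : Set V) := by
    intro x; simp [posRootsOf]
  let Mx : V → Prop := fun β => β ∈ P.posRootsOf S ∧
    ∀ δ ∈ P.posRootsOf S, δ - β ∈ AddSubmonoid.closure (S : Set V) → δ = β
  -- above every positive root there is a maximal one
  have above : ∀ α ∈ P.posRootsOf S, ∃ β, Mx β ∧ β - α ∈ AddSubmonoid.closure (S : Set V) := by
    intro α hα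
    let ht : V → ℚ := fun x => ∑ b ∈ Δ, C b x
    obtain ⟨β, hβ, hmax⟩ := Finset.exists_max_image
      ((P.posRootsOf S).filter fun δ => δ - α ∈ AddSubmonoid.closure (S : Set V)) ht
      ⟨α, by simp [hα]⟩
    rw [Finset.mem_filter] at hβ
    refine ⟨β, ⟨hβ.1, fun δ hδ hδβ => ?_⟩, hβ.2⟩
    have h1 := hmax δ (Finset.mem_filter.2 ⟨hδ, by
      have := add_mem hδβ hβ.2
      rwa [sub_add_sub_cancel] at this⟩)
    have hnn : ∀ b ∈ Δ, 0 ≤ C b (δ - β) := fun b hb => C_nonneg hC (nat_mono hS hδβ) hb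
    have h2 : ∑ b ∈ Δ, C b (δ - β) = ht δ - ht β := by
      simp only [ht, map_sub, Finset.sum_sub_distrib]
    have h3 : ∑ b ∈ Δ, C b (δ - β) = 0 :=
      le_antisymm (by rw [h2]; linarith) (Finset.sum_nonneg hnn)
    have h4 := (Finset.sum_eq_zero_iff_of_nonneg hnn).1 h3
    exact sub_eq_zero.1 (C_ext hC (nat_mono hS hδβ) h4)
  have dom : ∀ β, Mx β → ∀ a ∈ S, 0 ≤ P.pairInt β a := by
    rintro β ⟨hβ, hmax⟩ a ha
    obtain ⟨hβr, hβS⟩ := (mP β).1 hβ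
    by_contra! hlt
    have hne : β ≠ -a := by
      rintro rfl
      exact P.ne_zero a (hSR ha) (antisymm a (memS a ha) hβS)
    have hr := hadd β hβr a (hSR ha) hlt hne
    have := hmax (β + a) ((mP _).2 ⟨hr, add_mem hβS (memS a ha)⟩) (by simpa using memS a ha)
    exact P.ne_zero a (hSR ha) (by simpa using this)
  have dom' : ∀ β, Mx β → ∀ a ∈ S, 0 ≤ P.pairInt a β := by
    intro β hβ a ha
    have hβr := ((mP β).1 hβ.1).1
    have h1 := dom β hβ a ha
    rcases h1.lt_or_eq with h | h
    · exact (hpos _ hβr _ (hSR ha) h).le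
    · exact (hzero _ hβr _ (hSR ha) h.symm).ge
  -- full support
  have full : ∀ β, Mx β → ∀ f : V → ℕ, β = ∑ a ∈ S, f a • a → ∀ a ∈ S, f a ≠ 0 := by
    intro β hβ f hf
    have hβr := ((mP β).1 hβ.1).1
    have hex : ∃ a ∈ S, f a ≠ 0 := by
      by_contra! hcon
      apply P.ne_zero β hβr
      rw [hf]
      exact Finset.sum_eq_zero fun a ha => by simp [hcon a ha]
    obtain ⟨a, ha, hfa⟩ := hex
    intro b hbS
    have hl := hconn.2 a ha b hbS
    unfold Linked at hl
    clear hbS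
    induction hl with
    | refl => exact hfa
    | @tail c d _ hcd ih =>
      obtain ⟨hc, hd, hne⟩ := hcd
      intro hfd
      have h1 := dom β hβ d hd
      rw [pair_sum hSR hβr hf (hSR hd)] at h1
      have hcd : c ≠ d := by rintro rfl; exact ih hfd
      have : ∑ a ∈ S, (f a : ℤ) * P.pairInt a d < 0 := by
        refine Finset.sum_neg' (fun e he => ?_) ⟨c, hc, ?_⟩
        · by_cases hed : e = d
          · subst hed; simp [hfd]
          · exact mul_nonpos_of_nonneg_of_nonpos (by positivity)
              (pair_simple hb (hS he) (hS hd) hed)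
        · exact mul_neg_of_pos_of_neg (by positivity)
            (lt_of_le_of_ne (pair_simple hb (hS hc) (hS hd) hcd) hne)
      linarith
  have uniq : ∀ β, Mx β → ∀ β', Mx β' → β' = β := by
    intro β hβ β' hβ'
    obtain ⟨hβr, hβS⟩ := (mP β).1 hβ.1
    obtain ⟨hβr', hβS'⟩ := (mP β').1 hβ'.1
    obtain ⟨f, hf⟩ := mem_nat hβS
    obtain ⟨f', hf'⟩ := mem_nat hβS'
    have h2 := P.pair_self β hβr
    rw [pair_sum hSR hβr hf hβr] at h2
    obtain ⟨a, ha, hpa⟩ : ∃ a ∈ S, P.pairInt a β ≠ 0 := by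
      by_contra! hcon
      rw [Finset.sum_eq_zero fun a ha => by simp [hcon a ha]] at h2
      norm_num at h2
    have h3 : 0 < P.pairInt β' β := by
      rw [pair_sum hSR hβr' hf' hβr]
      refine Finset.sum_pos' (fun e he => mul_nonneg (by positivity) (dom' β hβ e he)) ⟨a, ha, ?_⟩
      have := full β' hβ' f' hf' a ha
      exact mul_pos (by positivity) (lt_of_le_of_ne (dom' β hβ a ha) hpa.symm)
    by_contra hne
    have hr := hsub _ hβr' _ hβr h3 hne
    rcases pm_of_int hb hC hS hr (sub_mem (nat_int hβS') (nat_int hβS)) with h | h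
    · exact hne (hβ.2 _ hβ'.1 h)
    · rw [neg_sub] at h
      exact hne (hβ'.2 _ hβ.1 h).symm
  obtain ⟨a0, ha0⟩ := hconn.1
  obtain ⟨ε, hε, -⟩ := above a0 ((mP a0).2 ⟨hSR ha0, memS a0 ha0⟩)
  refine ⟨ε, hε.1, fun α hα => ?_⟩
  simp only [rootsOf, Finset.mem_filter] at hα
  rcases pm_of_int hb hC hS hα.1 hα.2 with h | h
  · obtain ⟨β, hβ, hβα⟩ := above α ((mP α).2 ⟨hα.1, h⟩)
    rwa [uniq ε hε β hβ] at hβα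
  · rw [sub_eq_add_neg]
    exact add_mem ((mP ε).1 hε.1).2 h

theorem highestRoot_mem {Δ : Finset V} (hb : P.IsBase Δ) {S : Finset V} (hS : S ⊆ Δ)
    (hconn : P.IsConnected S) : P.highestRoot S ∈ P.roots := by
  have h := exists_highest hb hS hconn
  rw [highestRoot, dif_pos h]
  have := h.choose_spec.1
  simp only [posRootsOf, Finset.mem_filter] at this
  exact this.1

theorem linked_symm {S : Finset V} (hS : S ⊆ P.roots) {a b : V} (h : P.Linked S a b) :
    P.Linked S b a := by
  unfold Linked at *
  induction h with
  | refl => exact .refl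
  | tail _ hcd ih =>
    exact .head ⟨hcd.2.1, hcd.1, fun h0 =>
      hcd.2.2 (P.key_facts.2.2.1 _ (hS hcd.2.1) _ (hS hcd.1) h0)⟩ ih

theorem mem_component {S : Finset V} {a b : V} :
    b ∈ P.component S a ↔ b ∈ S ∧ P.Linked S a b := by simp [component]

theorem component_connected {S : Finset V} (hS : S ⊆ P.roots) {a : V} (ha : a ∈ S) :
    P.IsConnected (P.component S a) := by
  refine ⟨⟨a, mem_component.2 ⟨ha, .refl⟩⟩, ?_⟩
  have key : ∀ b, P.Linked S a b → P.Linked (P.component S a) a b := by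
    intro b h
    unfold Linked at h
    induction h with
    | refl => exact .refl
    | tail hac hcd ih =>
      exact .tail ih ⟨mem_component.2 ⟨hcd.1, hac⟩, mem_component.2 ⟨hcd.2.1, .tail hac hcd⟩,
        hcd.2.2⟩
  have hsub : P.component S a ⊆ P.roots := (Finset.filter_subset _ _).trans hS
  intro b hb c hc
  exact (linked_symm hsub (key b (mem_component.1 hb).2)).trans (key c (mem_component.1 hc).2)

theorem component_orth {S : Finset V} (hS : S ⊆ P.roots) {a a' : V}
    (hne : P.component S a ≠ P.component S a') :
    ∀ b ∈ P.component S a, ∀ b' ∈ P.component S a', b ≠ b' ∧ P.pairInt b b' = 0 := by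
  have nl : ¬ P.Linked S a a' := by
    intro h
    apply hne
    ext c
    rw [mem_component, mem_component]
    exact ⟨fun hc => ⟨hc.1, (linked_symm hS h).trans hc.2⟩, fun hc => ⟨hc.1, h.trans hc.2⟩⟩
  intro b hb b' hb'
  rw [mem_component] at hb hb'
  constructor
  · rintro rfl
    exact nl (hb.2.trans (linked_symm hS hb'.2))
  · by_contra h0
    have : P.Linked S b b' := Relation.ReflTransGen.single ⟨hb.1, hb'.1, h0⟩
    exact nl ((hb.2.trans this).trans (linked_symm hS hb'.2))

theorem mem_aux_succ {n : ℕ} {S K : Finset V} : K ∈ P.cascadeAux (n + 1) S ↔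
    ∃ a ∈ S, K = P.component S a ∨ K ∈ P.cascadeAux n (P.zeroPart (P.component S a)) := by
  simp [cascadeAux, components]

theorem zeroPart_subset (S : Finset V) : P.zeroPart S ⊆ S := Finset.filter_subset _ _

theorem component_subset (S : Finset V) (a : V) : P.component S a ⊆ S := Finset.filter_subset _ _

theorem aux_prop {n : ℕ} : ∀ {S K : Finset V}, S ⊆ P.roots → K ∈ P.cascadeAux n S →
    K ⊆ S ∧ P.IsConnected K := by
  induction n with
  | zero => intro S K _ h; simp [cascadeAux] at h
  | succ n ih =>
    intro S K hS h
    obtain ⟨a, ha, rfl | h⟩ := mem_aux_succ.1 h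
    · exact ⟨component_subset S a, component_connected hS ha⟩
    · have h' := (zeroPart_subset (P := P) _).trans (component_subset (P := P) S a)
      have := ih (h'.trans hS) h
      exact ⟨this.1.trans h', this.2⟩

theorem aux_pair {n : ℕ} : ∀ {S K K' : Finset V}, S ⊆ P.roots → K ∈ P.cascadeAux n S →
    K' ∈ P.cascadeAux n S → K = K' ∨ K ⊆ P.zeroPart K' ∨ K' ⊆ P.zeroPart K ∨
      ∀ b ∈ K, ∀ b' ∈ K', b ≠ b' ∧ P.pairInt b b' = 0 := by
  induction n with
  | zero => intro S K K' _ h; simp [cascadeAux] at h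
  | succ n ih =>
    intro S K K' hS h h'
    obtain ⟨a, ha, h⟩ := mem_aux_succ.1 h
    obtain ⟨a', ha', h'⟩ := mem_aux_succ.1 h'
    have hz : ∀ a, P.zeroPart (P.component S a) ⊆ P.roots := fun a =>
      ((zeroPart_subset (P := P) _).trans (component_subset (P := P) S a)).trans hS
    by_cases hc : P.component S a = P.component S a'
    · rw [← hc] at h'
      rcases h with rfl | h
      · rcases h' with rfl | h'
        · exact .inl rfl
        · exact .inr (.inr (.inl (aux_prop (hz a) h').1))
      · rcases h' with rfl | h'
        · exact .inr (.inl (aux_prop (hz a) h).1)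
        · exact ih (hz a) h h'
    · have sub : ∀ a K, (K = P.component S a ∨
          K ∈ P.cascadeAux n (P.zeroPart (P.component S a))) → K ⊆ P.component S a := by
        rintro a K (rfl | h)
        · exact subset_refl _
        · exact (aux_prop (hz a) h).1.trans (zeroPart_subset _)
      exact .inr (.inr (.inr fun b hb b' hb' =>
        component_orth hS hc b (sub a K h hb) b' (sub a' K' h' hb')))

theorem gamma_add_aux {Δ : Finset V} (hb : P.IsBase Δ) {K K' : Finset V} (hK' : K' ⊆ Δ)
    (hconn : P.IsConnected K') (hsub : K ⊆ P.zeroPart K') {α γ : V} (hα : α ∈ P.gamma K)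
    (hγ : γ ∈ P.gamma K') (hs : α + γ ∈ P.roots) : K ⊆ K' ∧ α + γ ∈ P.gamma K' := by
  have hKK : K ⊆ K' := hsub.trans (zeroPart_subset K')
  simp only [gamma, rootsOf, Finset.mem_filter] at hα hγ ⊢
  have hε := highestRoot_mem hb hK' hconn
  have h0 : P.pairInt α (P.highestRoot K') = 0 :=
    pair_zero ((hKK.trans hK').trans hb.subset) hα.1.1 hα.1.2 hε fun a ha =>
      (Finset.mem_filter.1 (hsub ha)).2
  refine ⟨hKK, ⟨hs, add_mem ?_ hγ.1.2⟩, ?_⟩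
  · exact AddSubgroup.closure_mono (by exact_mod_cast hKK) hα.1.2
  · rw [pair_add hα.1.1 hγ.1.1 hs hε, h0, zero_add]; exact hγ.2

end RootSystemData

variable {k V : Type*} [Field k] [CharZero k] [AddCommGroup V] [Module k V]

/-- Let `R` be a reduced root system with base `Π`, let `𝒦 = 𝒦(Π)` be the
cascade, and let `K, K' ∈ 𝒦`.  If `α ∈ Γ^K`, `γ ∈ Γ^{K'}` and `α + γ ∈ R`, then either
`K ⊆ K'` and `α + γ ∈ Γ^{K'}`, or `K' ⊆ K` and `α + γ ∈ Γ^K`. -/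
theorem gamma_add_gamma_mem
    (P : RootSystemData k V) (Δ : Finset V) (hbase : P.IsBase Δ)
    (K : Finset V) (hK : K ∈ P.cascade Δ) (K' : Finset V) (hK' : K' ∈ P.cascade Δ)
    (α : V) (hα : α ∈ P.gamma K) (γ : V) (hγ : γ ∈ P.gamma K')
    (hsum : α + γ ∈ P.roots) :
    (K ⊆ K' ∧ α + γ ∈ P.gamma K') ∨ (K' ⊆ K ∧ α + γ ∈ P.gamma K) := by
  have hr := hbase.subset
  have h1 := RootSystemData.aux_prop hr hK
  have h2 := RootSystemData.aux_prop hr hK'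
  rcases RootSystemData.aux_pair hr hK hK' with rfl | h | h | h
  · refine .inl ⟨subset_refl _, ?_⟩
    have hε := RootSystemData.highestRoot_mem hbase h1.1 h1.2
    simp only [RootSystemData.gamma, RootSystemData.rootsOf, Finset.mem_filter] at hα hγ ⊢
    refine ⟨⟨hsum, add_mem hα.1.2 hγ.1.2⟩, ?_⟩
    rw [RootSystemData.pair_add hα.1.1 hγ.1.1 hsum hε]
    exact add_pos hα.2 hγ.2
  · exact .inl (RootSystemData.gamma_add_aux hbase h2.1 h2.2 h hα hγ hsum)
  · rw [add_comm] at hsum ⊢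
    exact .inr (RootSystemData.gamma_add_aux hbase h1.1 h1.2 h hγ hα hsum)
  · simp only [RootSystemData.gamma, RootSystemData.rootsOf, Finset.mem_filter] at hα hγ
    exact (RootSystemData.orth_false hbase h1.1 h2.1 h hα.1.1 hα.1.2 hγ.1.1 hγ.1.2 hsum).elim
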